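/- Let (K, l, α) be a bosonic Gaussian channel with det K ≠ 0. Then there exist real symplectic matrices S₁ and S₂ (Sᵢ·J·Sᵢᵀ = J), vectors h₁, h₂ ∈ ℝ^{2n}, a real symmetric matrix R (Rᵀ = R), and a real diagonal matrix Λ such that S₁·K·S₂ = D·R, S₂ᵀ·Kᵀ·h₁ + S₂ᵀ·l + h₂ = 0, and S₂ᵀ·α·S₂ = Λ, where D is the block diagonal matrix D = [[Iₙ, 0], [0, -Iₙ]]. Equivalently, the channel (K, l, α) is transformed by inhomogeneous symplectic transformations into the channel (D·R, 0, Λ). -/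

import Mathlib

open Matrix
open scoped ComplexOrder

/-- The standard symplectic form matrix `J = [[0, -I_n], [I_n, 0]]`. -/
def symplJ (n : ℕ) : Matrix (Fin n ⊕ Fin n) (Fin n ⊕ Fin n) ℝ :=
  Matrix.fromBlocks 0 (-1) 1 0

/-- The block diagonal matrix `D = [[I_n, 0], [0, -I_n]]`. -/
def Dmat (n : ℕ) : Matrix (Fin n ⊕ Fin n) (Fin n ⊕ Fin n) ℝ :=
  Matrix.fromBlocks 1 0 0 (-1)

/-- The triple `(K, l, α)` is a bosonic Gaussian channel: `α` is symmetric and the complex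
matrix `α - (i/2)(J - Kᵀ·J·K)` is positive semidefinite. -/
def IsBosonicGaussianChannel (n : ℕ) (K : Matrix (Fin n ⊕ Fin n) (Fin n ⊕ Fin n) ℝ)
    (l : (Fin n ⊕ Fin n) → ℝ) (α : Matrix (Fin n ⊕ Fin n) (Fin n ⊕ Fin n) ℝ) : Prop :=
  αᵀ = α ∧
    (α.map (Complex.ofReal) -
      (Complex.I / 2) • ((symplJ n).map Complex.ofReal -
        (Kᵀ * symplJ n * K).map Complex.ofReal)).PosSemidef

open Polynomial Module

section BilinearForms

variable {K V : Type*} [Field K] [AddCommGroup V] [Module K V]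

theorem LinearMap.exists_comp_eq_of_surjective {M N : Type*} [AddCommGroup M] [Module K M]
    [AddCommGroup N] [Module K N] (c : M →ₗ[K] V) (d : M →ₗ[K] N)
    (hc : Function.Surjective c) (h : ∀ x, c x = 0 → d x = 0) :
    ∃ X : V →ₗ[K] N, ∀ x, X (c x) = d x := by
  obtain ⟨s, hs⟩ := c.exists_rightInverse_of_surjective (LinearMap.range_eq_top.2 hc)
  refine ⟨d ∘ₗ s, fun x => ?_⟩
  have := h (s (c x) - x) (by simpa [sub_eq_zero] using LinearMap.congr_fun hs (c x))
  simpa [sub_eq_zero] using this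

theorem LinearMap.exists_comp_eq {M N : Type*} [AddCommGroup M] [Module K M]
    [AddCommGroup N] [Module K N] (c : M →ₗ[K] V) (d : M →ₗ[K] N)
    (h : ∀ x, c x = 0 → d x = 0) :
    ∃ X : V →ₗ[K] N, ∀ x, X (c x) = d x := by
  obtain ⟨Y, hY⟩ := LinearMap.exists_comp_eq_of_surjective c.rangeRestrict d
    c.surjective_rangeRestrict (fun x hx => h x (congrArg Subtype.val hx))
  obtain ⟨X, hX⟩ := Y.exists_extend
  exact ⟨X, fun x => (LinearMap.congr_fun hX (c.rangeRestrict x)).trans (hY x)⟩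

theorem LinearMap.BilinForm.IsAlt.nondegenerate_of_separatingLeft {ω : LinearMap.BilinForm K V}
    (hω : ω.IsAlt) (h : ∀ x, (∀ y, ω x y = 0) → x = 0) : ω.Nondegenerate :=
  ⟨h, fun x hx => h x fun y => by rw [← hω.neg_eq, hx, neg_zero]⟩

theorem LinearMap.BilinForm.IsAlt.isCompl_orthogonal [FiniteDimensional K V]
    {ω : LinearMap.BilinForm K V} (hω : ω.IsAlt) (hn : ω.Nondegenerate) (P : Submodule K V)
    (h : ∀ x ∈ P, (∀ y ∈ P, ω x y = 0) → x = 0) :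
    IsCompl P (ω.orthogonal P) ∧ (ω.restrict (ω.orthogonal P)).IsAlt ∧
      (ω.restrict (ω.orthogonal P)).Nondegenerate := by
  have hP : (ω.restrict P).Nondegenerate :=
    IsAlt.nondegenerate_of_separatingLeft (fun x => hω x)
      fun x hx => Subtype.ext (h x x.2 fun y hy => hx ⟨y, hy⟩)
  have hc := isCompl_orthogonal_of_restrict_nondegenerate hω.isRefl hP
  refine ⟨hc, fun x => hω x, ?_⟩
  rw [restrict_nondegenerate_iff_isCompl_orthogonal hω.isRefl,
    orthogonal_orthogonal hn hω.isRefl]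
  exact hc.symm

theorem LinearMap.BilinForm.apply_aeval_comm {ω : LinearMap.BilinForm K V} {W : End K V}
    (hW : ∀ x y, ω (W x) y = ω x (W y)) (q : K[X]) (x y : V) :
    ω (aeval W q x) y = ω x (aeval W q y) := by
  induction q using Polynomial.induction_on generalizing x y with
  | C a => simp
  | add p q hp hq => simp [hp, hq]
  | monomial n a ih =>
    rw [pow_succ, ← mul_assoc]
    simp only [map_mul, aeval_X, Module.End.mul_apply] at ih ⊢
    have h : aeval W (X * (C a * X ^ n)) y = aeval W (C a * X ^ n * X) y := by rw [mul_comm]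
    simp only [map_mul, aeval_X, Module.End.mul_apply] at h
    rw [ih, hW, h]

/-- The functional `q ↦ coeff (q %ₘ p) (deg p - 1)` makes `K[X] ⧸ (p)` a Frobenius algebra. -/
theorem Polynomial.exists_frobenius_functional {p : K[X]} (hp : p.Monic) :
    ∃ φ : K[X] →ₗ[K] K, (∀ q, p ∣ q → φ q = 0) ∧
      ∀ q, (∀ s, φ (s * q) = 0) → p ∣ q := by
  refine ⟨lcoeff K (p.natDegree - 1) ∘ₗ modByMonicHom p, fun q hq => ?_, fun q hq => ?_⟩
  · simp [(modByMonic_eq_zero_iff_dvd hp).2 hq]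
  · by_contra hdvd
    have hr : q %ₘ p ≠ 0 := fun h => hdvd ((modByMonic_eq_zero_iff_dvd hp).1 h)
    have hp1 : p ≠ 1 := by rintro rfl; exact hdvd (one_dvd q)
    have hlt : (q %ₘ p).natDegree < p.natDegree := natDegree_modByMonic_lt q hp hp1
    set r := q %ₘ p with hr_def
    have hmod : (X ^ (p.natDegree - 1 - r.natDegree) * q) %ₘ p
        = X ^ (p.natDegree - 1 - r.natDegree) * r := by
      have h1 : (X ^ (p.natDegree - 1 - r.natDegree) * q) %ₘ p
          = (X ^ (p.natDegree - 1 - r.natDegree) * r) %ₘ p := by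
        refine modByMonic_eq_of_dvd_sub hp ?_
        rw [← mul_sub, show q - r = p * (q /ₘ p) by rw [hr_def, modByMonic_eq_sub_mul_div]; ring]
        exact dvd_mul_of_dvd_right (dvd_mul_right _ _) _
      rw [h1, modByMonic_eq_self_iff hp]
      apply degree_lt_degree
      rw [natDegree_X_pow_mul _ hr]
      omega
    have := hq (X ^ (p.natDegree - 1 - r.natDegree))
    simp only [LinearMap.comp_apply, modByMonicHom_apply, hmod, lcoeff_apply] at this
    rw [show p.natDegree - 1 = r.natDegree + (p.natDegree - 1 - r.natDegree) by omega,
      Nat.add_sub_cancel_left, coeff_X_pow_mul] at this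
    exact hr (leadingCoeff_eq_zero.1 this)

theorem Module.End.exists_aeval_apply_eq_zero_iff_minpoly_dvd [FiniteDimensional K V]
    (W : End K V) : ∃ v : V, ∀ q : K[X], aeval W q v = 0 ↔ minpoly K W ∣ q := by
  obtain ⟨x, hx⟩ := exists_ker_toSpanSingleton_eq_annihilator K[X] (AEval' W)
  obtain ⟨v, rfl⟩ := (AEval'.of W).surjective x
  refine ⟨v, fun q => ?_⟩
  rw [← Ideal.mem_span_singleton, span_minpoly_eq_annihilator, ← hx, LinearMap.mem_ker,
    LinearMap.toSpanSingleton_apply]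
  rw [← AEval.of_aeval_smul]
  exact (LinearEquiv.map_eq_zero_iff _).symm

/-- Two cyclic vectors whose cyclic subspaces are paired nondegenerately by `ω`. -/
theorem LinearMap.BilinForm.exists_cyclic_pair [FiniteDimensional K V]
    {ω : LinearMap.BilinForm K V} (hn : ω.Nondegenerate) {W : End K V}
    (hW : ∀ x y, ω (W x) y = ω x (W y)) :
    ∃ v w : V, (∀ q : K[X], aeval W q v = 0 ↔ minpoly K W ∣ q) ∧
      ∀ q : K[X], (∀ s : K[X], ω (aeval W s w) (aeval W q v) = 0) → minpoly K W ∣ q := by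
  obtain ⟨v, hv⟩ := Module.End.exists_aeval_apply_eq_zero_iff_minpoly_dvd W
  obtain ⟨φ, hφ, hφ'⟩ :=
    exists_frobenius_functional (minpoly.monic (Algebra.IsIntegral.isIntegral (R := K) W))
  obtain ⟨ψ, hψ⟩ := LinearMap.exists_comp_eq
    ((LinearMap.applyₗ v : End K V →ₗ[K] V) ∘ₗ (aeval W).toLinearMap) φ
    (fun q hq => hφ q ((hv q).1 hq))
  refine ⟨v, (ω.toDual hn).symm ψ, hv, fun q hq => hφ' q fun s => ?_⟩
  rw [← hψ, ← hq s, apply_aeval_comm hW, apply_toDual_symm_apply]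
  simp [Module.End.mul_apply]

theorem LinearMap.BilinForm.IsAlt.apply_aeval_self [NeZero (2 : K)]
    {ω : LinearMap.BilinForm K V} (hω : ω.IsAlt) {W : End K V}
    (hW : ∀ x y, ω (W x) y = ω x (W y)) (q s : K[X]) (x : V) :
    ω (aeval W q x) (aeval W s x) = 0 := by
  have h := apply_aeval_comm hW (q * s) x x
  rw [← hω.neg_eq] at h
  rw [apply_aeval_comm hW, ← Module.End.mul_apply, ← map_mul]
  have h2 : (2 : K) * ω x (aeval W (q * s) x) = 0 := by linear_combination -h
  exact (mul_eq_zero.1 h2).resolve_left two_ne_zero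

/-- An endomorphism that is self-adjoint for a symplectic form has a square root that is
skew-adjoint for that form. -/
theorem LinearMap.BilinForm.IsAlt.exists_skewAdjoint_sq_eq {K : Type*} [Field K]
    [NeZero (2 : K)] {V : Type*} [AddCommGroup V] [Module K V] [FiniteDimensional K V]
    {ω : LinearMap.BilinForm K V} (hω : ω.IsAlt) (hn : ω.Nondegenerate) {W : End K V}
    (hW : ∀ x y, ω (W x) y = ω x (W y)) :
    ∃ Y : End K V, (∀ x, Y (Y x) = W x) ∧ ∀ x y, ω (Y x) y = -ω x (Y y) := by
  rcases subsingleton_or_nontrivial V with hV | hV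
  · exact ⟨0, fun x => Subsingleton.elim _ _, by simp⟩
  obtain ⟨v, w, hv, hvw⟩ := exists_cyclic_pair hn hW
  have hcross (q s : K[X]) : ω (aeval W q w) (aeval W s v) = ω (aeval W s w) (aeval W q v) := by
    rw [apply_aeval_comm hW, apply_aeval_comm hW, ← Module.End.mul_apply, ← Module.End.mul_apply,
      ← map_mul, ← map_mul, mul_comm]
  have haeval {q : K[X]} (hq : minpoly K W ∣ q) (x : V) : aeval W q x = 0 := by
    rw [(minpoly.dvd_iff).1 hq, LinearMap.zero_apply]
  let cyc (x : V) : K[X] →ₗ[K] V := LinearMap.applyₗ x ∘ₗ (aeval W).toLinearMap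
  let c : K[X] × K[X] →ₗ[K] V := (cyc v).coprod (cyc w)
  have hc (z) : c z = aeval W z.1 v + aeval W z.2 w := rfl
  let P := LinearMap.range c
  have hωc (z z') : ω (c z) (c z') =
      ω (aeval W z.2 w) (aeval W z'.1 v) - ω (aeval W z'.2 w) (aeval W z.1 v) := by
    simp only [hc, map_add, LinearMap.add_apply, hω.apply_aeval_self hW]
    rw [← hω.neg_eq (aeval W z.1 v)]
    ring
  have hdvd (z) (hz : ∀ z', ω (c z) (c z') = 0) : minpoly K W ∣ z.1 ∧ minpoly K W ∣ z.2 := by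
    refine ⟨hvw _ fun s => ?_, hvw _ fun s => ?_⟩
    · simpa [hωc] using hz (0, s)
    · rw [hcross]
      simpa [hωc] using hz (s, 0)
  obtain ⟨hcompl, hQalt, hQn⟩ := hω.isCompl_orthogonal hn P (by
    rintro _ ⟨z, rfl⟩ hz
    obtain ⟨h1, h2⟩ := hdvd z fun z' => hz _ ⟨z', rfl⟩
    rw [hc, haeval h1, haeval h2, add_zero])
  set Q := ω.orthogonal P
  have horth (z) (u : V) (hu : u ∈ Q) : ω (c z) u = 0 := hu _ ⟨z, rfl⟩
  have horth' (z) (u : V) (hu : u ∈ Q) : ω u (c z) = 0 := by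
    rw [← hω.neg_eq, horth z u hu, neg_zero]
  have hWc (z : K[X] × K[X]) : W (c z) = c (X * z.1, X * z.2) := by
    simp [hc]
  have hWQ (u : V) (hu : u ∈ Q) : W u ∈ Q := by
    rintro _ ⟨z, rfl⟩
    change ω (c z) (W u) = 0
    rw [← hW, hWc, horth _ _ hu]
  have hlt : finrank K Q < finrank K V := by
    have hP : P ≠ ⊥ := fun h => by
      have h0 : c (1, 0) = 0 := by
        rw [← Submodule.mem_bot K, ← h]
        exact ⟨_, rfl⟩
      have h1 : aeval W (1 : K[X]) v = 0 := by simpa [hc] using h0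
      exact minpoly.not_isUnit K W (isUnit_of_dvd_one ((hv 1).1 h1))
    have := Submodule.finrank_add_eq_of_isCompl hcompl
    have := Submodule.one_le_finrank_iff.2 hP
    omega
  obtain ⟨Z, hZsq, hZskew⟩ := hQalt.exists_skewAdjoint_sq_eq hQn (W := W.restrict hWQ)
    (fun x y => hW x y)
  let e : (K[X] × K[X]) × Q →ₗ[K] V := c.coprod Q.subtype
  let d : (K[X] × K[X]) × Q →ₗ[K] (K[X] × K[X]) × Q :=
    ((LinearMap.mulLeft K X ∘ₗ LinearMap.snd K _ _).prod (LinearMap.fst K _ _)).prodMap Z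
  have he (z u) : e (z, u) = c z + u := rfl
  have hd (z u) : d (z, u) = ((X * z.2, z.1), Z u) := rfl
  have hesurj : Function.Surjective e := by
    rw [← LinearMap.range_eq_top, LinearMap.range_coprod, Submodule.range_subtype]
    exact hcompl.sup_eq_top
  obtain ⟨Y, hY⟩ := LinearMap.exists_comp_eq_of_surjective e (e ∘ₗ d) hesurj (by
    rintro ⟨z, u⟩ hzu
    rw [he] at hzu
    have hcz : c z = 0 := by
      refine (Submodule.disjoint_def.1 hcompl.disjoint) _ ⟨z, rfl⟩ ?_
      rw [eq_neg_of_add_eq_zero_left hzu]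
      exact Q.neg_mem u.2
    have hu : u = 0 := by simpa [hcz] using hzu
    obtain ⟨h1, h2⟩ := hdvd z (by simp [hcz])
    rw [LinearMap.comp_apply, hd, he, hc]
    simp [haeval h1, haeval h2, hu])
  have hY' (z) (u : Q) : Y (c z + u) = c (X * z.2, z.1) + Z u := by
    rw [← he, hY, LinearMap.comp_apply, hd, he]
  refine ⟨Y, fun x => ?_, fun x y => ?_⟩
  · obtain ⟨⟨z, u⟩, rfl⟩ := hesurj x
    rw [he, hY', hY', hZsq, map_add, hWc]
    rfl
  · obtain ⟨⟨z, u⟩, rfl⟩ := hesurj x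
    obtain ⟨⟨z', u'⟩, rfl⟩ := hesurj y
    have hZ : ω (Z u) u' = -ω u (Z u') := hZskew u u'
    rw [he, he, hY', hY']
    simp only [map_add, LinearMap.add_apply, horth _ _ (Subtype.mem _),
      horth' _ _ (Subtype.mem _), hZ, hωc]
    rw [hcross z.1, hcross z'.1]
    have hX (q s : K[X]) : ω (aeval W q w) (aeval W (X * s) v)
        = ω (aeval W s w) (aeval W (X * q) v) := by
      rw [hcross]
      simp [hW]
    rw [hX]
    ring
termination_by finrank K V

end BilinearForms

section SymplecticDiagonalization

theorem Module.End.exists_aeval_apply_eq_zero_of_dvd_minpoly {K V : Type*} [Field K]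
    [AddCommGroup V] [Module K V] [FiniteDimensional K V] {T : End K V} {d : K[X]}
    (hd : d ∣ minpoly K T) (hu : ¬IsUnit d) : ∃ x ≠ 0, aeval T d x = 0 := by
  by_contra! h
  obtain ⟨s, hs⟩ := hd
  have hs0 : s ≠ 0 := by
    rintro rfl
    exact minpoly.ne_zero (Algebra.IsIntegral.isIntegral (R := K) T) (by simpa using hs)
  have hsT : aeval T s = 0 := by
    ext y
    by_contra hy
    refine h _ hy ?_
    rw [← Module.End.mul_apply, ← map_mul, ← hs, minpoly.aeval, LinearMap.zero_apply]
  have hdvd := minpoly.dvd K T hsT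
  rw [hs] at hdvd
  refine hu (isUnit_of_dvd_one ((mul_dvd_mul_iff_right hs0).1 ?_))
  simpa using hdvd

variable {V : Type*} [AddCommGroup V] [Module ℝ V]

theorem LinearMap.BilinForm.apply_eq_zero_of_apply_self_eq_zero {g : LinearMap.BilinForm ℝ V}
    (hg : ∀ x y, g x y = g y x) (hpos : ∀ x, 0 ≤ g x x) {x : V} (hx : g x x = 0) (y : V) :
    g x y = 0 := by
  have h := g.apply_mul_apply_le_of_forall_zero_le hpos x y
  rw [hx, zero_mul, hg y x] at h
  exact mul_self_eq_zero.1 (le_antisymm h (mul_self_nonneg _))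

variable [FiniteDimensional ℝ V]

/-- The square of the Hamiltonian endomorphism of a positive semidefinite form has a real
eigenvector outside the kernel of that endomorphism. -/
theorem LinearMap.BilinForm.exists_sq_eigenvector {ω g : LinearMap.BilinForm ℝ V} (hω : ω.IsAlt)
    (hg : ∀ x y, g x y = g y x) (hpos : ∀ x, 0 ≤ g x x) {A : End ℝ V} (hn : ω.Nondegenerate)
    (hA : ∀ x y, ω (A x) y = g x y) (hA0 : A ≠ 0) :
    ∃ (e : V) (μ : ℝ), A (A e) = μ • e ∧ A e ≠ 0 := by
  by_contra! h
  have hskew (x y) : g (A x) y = -g x (A y) := by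
    rw [hg (A x), ← hA, ← hA, hω.neg_eq]
  have hker (x) (hx : g x x = 0) : A x = 0 := by
    refine hn.1 _ fun y => ?_
    rw [hA, apply_eq_zero_of_apply_self_eq_zero hg hpos hx]
  set T : End ℝ V := A * A with hT
  have hTA (x) : T x = A (A x) := rfl
  have hp0 := minpoly.ne_zero (Algebra.IsIntegral.isIntegral (R := ℝ) T)
  obtain ⟨q, hq, hXq⟩ := exists_eq_pow_rootMultiplicity_mul_and_not_dvd (minpoly ℝ T) hp0 0
  rw [C_0, sub_zero] at hq hXq
  have hqdvd : q ∣ minpoly ℝ T := ⟨_, hq.trans (mul_comm _ _)⟩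
  by_cases hdeg : q.degree = 0
  · have hTk : T ^ (minpoly ℝ T).rootMultiplicity 0 = 0 := by
      rw [eq_C_of_degree_eq_zero hdeg] at hq
      have hc : q.coeff 0 ≠ 0 := fun hc => hp0 (by rw [hq, hc]; simp)
      have h0 := minpoly.aeval ℝ T
      rw [hq, map_mul, map_pow, aeval_X, aeval_C] at h0
      ext x
      have := LinearMap.congr_fun h0 ((q.coeff 0)⁻¹ • x)
      simpa [Module.algebraMap_end_apply, hc] using this
    have hnil (j : ℕ) : A ^ (j + 1) ≠ 0 := by
      induction j with
      | zero => simpa using hA0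
      | succ j ih =>
        refine fun hj => ih (LinearMap.ext fun x => ?_)
        have := h ((A ^ j) x) 0
        simp only [← Module.End.mul_apply, ← pow_succ', zero_smul] at this
        exact this (by rw [hj]; rfl)
    apply hnil (2 * (minpoly ℝ T).rootMultiplicity 0)
    rw [pow_succ, pow_mul, pow_two, ← hT, hTk, zero_mul]
  · obtain ⟨z, hz⟩ := IsAlgClosed.exists_aeval_eq_zero ℂ q hdeg
    have hz0 : z ≠ 0 := by
      rintro rfl
      refine hXq (X_dvd_iff.2 ?_)
      rwa [← map_zero (algebraMap ℝ ℂ), aeval_algebraMap_apply, ← coeff_zero_eq_aeval_zero,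
        (algebraMap ℝ ℂ).injective.eq_iff] at hz
    by_cases him : z.im = 0
    · have hzre : z = algebraMap ℝ ℂ z.re := Complex.ext rfl him
      have hroot : q.IsRoot z.re := by
        rw [hzre, aeval_algebraMap_apply] at hz
        simpa using hz
      obtain ⟨x, hx0, hx⟩ := Module.End.exists_aeval_apply_eq_zero_of_dvd_minpoly
        ((dvd_iff_isRoot.2 hroot).trans hqdvd) (not_isUnit_X_sub_C _)
      have hTx : A (A x) = z.re • x := by
        simpa [sub_eq_zero, Module.algebraMap_end_apply, hTA] using hx
      have hre : z.re = 0 := by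
        have := h x _ hTx
        rw [this, map_zero, eq_comm, smul_eq_zero] at hTx
        exact hTx.resolve_right hx0
      exact hz0 (Complex.ext hre him)
    · have hd := q.quadratic_dvd_of_aeval_eq_zero_im_ne_zero hz him
      obtain ⟨x, hx0, hx⟩ := Module.End.exists_aeval_apply_eq_zero_of_dvd_minpoly
        (hd.trans hqdvd) (not_isUnit_of_natDegree_pos _ (by
          have : (X ^ 2 - C (2 * z.re) * X + C (‖z‖ ^ 2)).natDegree = 2 := by compute_degree!
          omega))
      have hTx : T (T x) - (2 * z.re) • T x + (‖z‖ ^ 2) • x = 0 := by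
        simpa only [map_add, map_sub, map_mul (aeval T), map_pow (aeval T) X, aeval_X, aeval_C,
          pow_two T, LinearMap.add_apply, LinearMap.sub_apply, Module.End.mul_apply,
          Module.algebraMap_end_apply] using hx
      have hnorm : ‖z‖ ^ 2 = z.re ^ 2 + z.im ^ 2 := by
        rw [Complex.sq_norm, Complex.normSq_apply]; ring
      have hsum : g (T x - z.re • x) (T x - z.re • x) + z.im ^ 2 * g x x = 0 := by
        have h1 := congrArg (g x) hTx
        have hTT : g (T x) (T x) = g x (T (T x)) := by
          rw [hTA x, hskew, hskew, neg_neg]; rfl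
        simp only [map_add, map_sub, map_smul, smul_eq_mul, map_zero, hnorm] at h1
        simp only [map_sub, map_smul, smul_eq_mul, LinearMap.sub_apply, LinearMap.smul_apply,
          hg (T x) x, hTT]
        linear_combination h1
      have hxx : g x x = 0 := by
        have h1 := hpos (T x - z.re • x)
        have h2 := hpos x
        have h3 : 0 < z.im ^ 2 := by positivity
        nlinarith
      have hTx0 : T x = 0 := by rw [hTA, hker x hxx, map_zero]
      rw [hTx0, map_zero, smul_zero, sub_zero, zero_add, smul_eq_zero] at hTx
      exact hTx.elim (by simpa using hz0) hx0

/-- A symplectic pair whose symplectic complement is also `g`-orthogonal to it. -/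
theorem LinearMap.BilinForm.exists_symplectic_pair [Nontrivial V]
    {ω g : LinearMap.BilinForm ℝ V} (hω : ω.IsAlt) (hn : ω.Nondegenerate)
    (hg : ∀ x y, g x y = g y x) (hpos : ∀ x, 0 ≤ g x x) :
    ∃ e f : V, ω f e = 1 ∧ g e f = 0 ∧
      ∀ u, ω e u = 0 → ω f u = 0 → g e u = 0 ∧ g f u = 0 := by
  let A : End ℝ V := (ω.toDual hn).symm.toLinearMap ∘ₗ g
  have hA (x y) : ω (A x) y = g x y :=
    apply_toDual_symm_apply (hB := hn) (g x) y
  by_cases hA0 : A = 0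
  · have hg0 (x y) : g x y = 0 := by rw [← hA, hA0]; simp
    obtain ⟨e, he⟩ := exists_ne (0 : V)
    obtain ⟨f, hf⟩ : ∃ f, ω f e ≠ 0 := by
      by_contra! hf
      exact he (hn.2 e hf)
    exact ⟨e, (ω f e)⁻¹ • f, by simp [hf], hg0 _ _, fun u _ _ => ⟨hg0 _ _, hg0 _ _⟩⟩
  · obtain ⟨e, μ, he, hAe⟩ := exists_sq_eigenvector hω hg hpos hn hA hA0
    have hee : g e e ≠ 0 := by
      refine fun hee => hAe (hn.1 _ fun y => ?_)
      rw [hA, apply_eq_zero_of_apply_self_eq_zero hg hpos hee]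
    refine ⟨e, (g e e)⁻¹ • A e, by simp [hA, hee], ?_, fun u h1 h2 => ⟨?_, ?_⟩⟩
    · rw [map_smul, ← hA e (A e), hω, smul_zero]
    · rw [← hA]
      simpa [hee] using h2
    · rw [← hA, map_smul, he]
      simp [h1]

/-- **Williamson's theorem** for a positive semidefinite form: some symplectic basis is
orthogonal for it. -/
theorem LinearMap.BilinForm.exists_symplectic_orthogonal_family (n : ℕ) {V : Type*}
    [AddCommGroup V] [Module ℝ V] [FiniteDimensional ℝ V] (hV : finrank ℝ V = 2 * n)
    {ω g : LinearMap.BilinForm ℝ V} (hω : ω.IsAlt) (hn : ω.Nondegenerate)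
    (hg : ∀ x y, g x y = g y x) (hpos : ∀ x, 0 ≤ g x x) :
    ∃ e f : Fin n → V, (∀ i j, ω (e i) (e j) = 0) ∧ (∀ i j, ω (f i) (f j) = 0) ∧
      (∀ i j, ω (f i) (e j) = if i = j then 1 else 0) ∧ (∀ i j, g (e i) (f j) = 0) ∧
      (∀ i j, i ≠ j → g (e i) (e j) = 0) ∧ ∀ i j, i ≠ j → g (f i) (f j) = 0 := by
  induction n generalizing V with
  | zero => exact ⟨Fin.elim0, Fin.elim0, by simp, by simp, by simp, by simp, by simp, by simp⟩
  | succ n ih =>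
    have : Nontrivial V := nontrivial_of_finrank_pos (R := ℝ) (by omega)
    obtain ⟨e, f, hfe, hgef, hgu⟩ := exists_symplectic_pair hω hn hg hpos
    have hef : ω e f = -1 := by rw [← hω.neg_eq, hfe]
    let P := Submodule.span ℝ {e, f}
    obtain ⟨-, hQalt, hQn⟩ := hω.isCompl_orthogonal hn P (by
      intro x hx h
      obtain ⟨a, b, rfl⟩ := Submodule.mem_span_pair.1 hx
      have h1 := h e (Submodule.subset_span (by simp))
      have h2 := h f (Submodule.subset_span (by simp))
      simp [hω e, hω f, hef, hfe] at h1 h2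
      simp [h1, h2])
    have hP : finrank ℝ P = 2 := by
      have hli : LinearIndependent ℝ ![e, f] := LinearIndependent.pair_iff.2 fun a b hab => by
        have h1 := congrArg (ω f) hab
        have h2 := congrArg (ω e) hab
        simp only [map_add, map_smul, map_zero, hω e, hω f, hfe, hef, smul_eq_mul] at h1 h2
        exact ⟨by linarith, by linarith⟩
      have h := finrank_span_eq_card hli
      rwa [Matrix.range_cons_cons_empty, Fintype.card_fin] at h
    set Q := ω.orthogonal P with hQ
    have hQP (x) (hx : x ∈ P) (u : Q) : ω x u = 0 := u.2 x hx
    have hQe (u : Q) : ω e u = 0 := hQP _ (Submodule.subset_span (by simp)) u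
    have hQf (u : Q) : ω f u = 0 := hQP _ (Submodule.subset_span (by simp)) u
    have hQe' (u : Q) : ω u e = 0 := by rw [← hω.neg_eq, hQe, neg_zero]
    have hQf' (u : Q) : ω u f = 0 := by rw [← hω.neg_eq, hQf, neg_zero]
    have hge (u : Q) : g e u = 0 := (hgu u (hQe u) (hQf u)).1
    have hgf (u : Q) : g f u = 0 := (hgu u (hQe u) (hQf u)).2
    have hge' (u : Q) : g u e = 0 := (hg u e).trans (hge u)
    have hgf' (u : Q) : g u f = 0 := (hg u f).trans (hgf u)
    obtain ⟨e', f', h1, h2, h3, h4, h5, h6⟩ := ih (V := Q)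
      (by rw [hQ, finrank_orthogonal hn]; omega) hQalt hQn
      (g := g.restrict Q) (fun x y => hg x y) (fun x => hpos x)
    simp only [restrict_apply, domRestrict_apply] at h1 h2 h3 h4 h5 h6
    refine ⟨Fin.cons e (fun i => e' i), Fin.cons f (fun i => f' i),
      Fin.cases (Fin.cases (hω e) fun j => hQe _) fun i => Fin.cases (hQe' _) fun j => h1 i j,
      Fin.cases (Fin.cases (hω f) fun j => hQf _) fun i => Fin.cases (hQf' _) fun j => h2 i j,
      Fin.cases (Fin.cases ?_ fun j => ?_) fun i => Fin.cases ?_ fun j => ?_,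
      Fin.cases (Fin.cases hgef fun j => hge _) fun i => Fin.cases (hgf' _) fun j => h4 i j,
      Fin.cases (Fin.cases (absurd rfl) fun j _ => hge _) fun i => Fin.cases (fun _ => hge' _)
        fun j hij => h5 i j (by simpa using hij),
      Fin.cases (Fin.cases (absurd rfl) fun j _ => hgf _) fun i => Fin.cases (fun _ => hgf' _)
        fun j hij => h6 i j (by simpa using hij)⟩
    · simpa using hfe
    · simpa [(Fin.succ_ne_zero j).symm] using hQf (e' j)
    · simpa [Fin.succ_ne_zero] using hQe' (f' i)
    · simpa using h3 i j

end SymplecticDiagonalization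

section SymplecticMatrices

variable {n : ℕ}

theorem symplJ_eq_J : symplJ n = Matrix.J (Fin n) ℝ := rfl

theorem symplJ_transpose : (symplJ n)ᵀ = -symplJ n := Matrix.J_transpose _ _

theorem symplJ_mul_symplJ : symplJ n * symplJ n = -1 := Matrix.J_squared _ _

theorem Dmat_transpose : (Dmat n)ᵀ = Dmat n := by
  simp [Dmat, Matrix.fromBlocks_transpose]

theorem Dmat_mul_Dmat : Dmat n * Dmat n = 1 := by
  simp [Dmat, Matrix.fromBlocks_multiply]

theorem Dmat_mul_symplJ_mul_Dmat : Dmat n * symplJ n * Dmat n = -symplJ n := by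
  simp [Dmat, symplJ, Matrix.fromBlocks_multiply, Matrix.fromBlocks_neg]

theorem symplectic_iff_transpose {S : Matrix (Fin n ⊕ Fin n) (Fin n ⊕ Fin n) ℝ} :
    S * symplJ n * Sᵀ = symplJ n ↔ Sᵀ * symplJ n * S = symplJ n := by
  rw [symplJ_eq_J, ← SymplecticGroup.mem_iff, SymplecticGroup.mem_iff']

theorem isAlt_toBilin'_symplJ : (Matrix.toBilin' (symplJ n)).IsAlt := fun x => by
  have h : x ⬝ᵥ symplJ n *ᵥ x = -(x ⬝ᵥ symplJ n *ᵥ x) := by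
    conv_lhs => rw [Matrix.dotProduct_mulVec, ← Matrix.mulVec_transpose, symplJ_transpose,
      Matrix.neg_mulVec, neg_dotProduct, dotProduct_comm]
  rw [Matrix.toBilin'_apply']
  linarith

theorem nondegenerate_toBilin'_symplJ : (Matrix.toBilin' (symplJ n)).Nondegenerate :=
  LinearMap.BilinForm.nondegenerate_toBilin'_of_det_ne_zero' _ (Matrix.isUnit_det_J _ _).ne_zero

theorem transpose_mul_mul_apply_eq_toBilin' {ι : Type*} [Fintype ι] [DecidableEq ι]
    (S N : Matrix ι ι ℝ) (s t : ι) : (Sᵀ * N * S) s t = Matrix.toBilin' N (Sᵀ s) (Sᵀ t) := by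
  rw [Matrix.toBilin'_apply', Matrix.mul_assoc]
  rfl

theorem IsBosonicGaussianChannel.dotProduct_mulVec_nonneg
    {K α : Matrix (Fin n ⊕ Fin n) (Fin n ⊕ Fin n) ℝ} {l : (Fin n ⊕ Fin n) → ℝ}
    (h : IsBosonicGaussianChannel n K l α) (x : (Fin n ⊕ Fin n) → ℝ) : 0 ≤ x ⬝ᵥ α *ᵥ x := by
  have hx := (Complex.le_def.1 (h.2.dotProduct_mulVec_nonneg (fun i => (x i : ℂ)))).1
  simpa [dotProduct, Matrix.mulVec, Finset.mul_sum] using hx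

theorem exists_symplectic_diagonalization {α : Matrix (Fin n ⊕ Fin n) (Fin n ⊕ Fin n) ℝ}
    (hα : αᵀ = α) (hpos : ∀ x, 0 ≤ x ⬝ᵥ α *ᵥ x) :
    ∃ S : Matrix (Fin n ⊕ Fin n) (Fin n ⊕ Fin n) ℝ,
      S * symplJ n * Sᵀ = symplJ n ∧ ∃ d, Sᵀ * α * S = Matrix.diagonal d := by
  obtain ⟨e, f, hee, hff, hfe, gef, gee, gff⟩ :=
    LinearMap.BilinForm.exists_symplectic_orthogonal_family n (V := (Fin n ⊕ Fin n) → ℝ)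
      (by simp [two_mul]) isAlt_toBilin'_symplJ nondegenerate_toBilin'_symplJ
      (g := Matrix.toBilin' α)
      (fun x y => by
        rw [Matrix.toBilin'_apply', Matrix.toBilin'_apply', Matrix.dotProduct_mulVec,
          ← Matrix.mulVec_transpose, hα, dotProduct_comm])
      (fun x => by rw [Matrix.toBilin'_apply']; exact hpos x)
  have hef (i j) : Matrix.toBilin' (symplJ n) (e i) (f j) = if i = j then -1 else 0 := by
    rw [← isAlt_toBilin'_symplJ.neg_eq, hfe]
    split_ifs <;> simp_all
  have gfe (i j) : Matrix.toBilin' α (f i) (e j) = 0 := by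
    rw [← gef j i, Matrix.toBilin'_apply', Matrix.toBilin'_apply', Matrix.dotProduct_mulVec,
      ← Matrix.mulVec_transpose, hα, dotProduct_comm]
  let S : Matrix (Fin n ⊕ Fin n) (Fin n ⊕ Fin n) ℝ := (Matrix.of (Sum.elim e f))ᵀ
  refine ⟨S, symplectic_iff_transpose.2 ?_, fun s => (Sᵀ * α * S) s s, ?_⟩
  · ext s t
    rw [transpose_mul_mul_apply_eq_toBilin']
    rcases s with i | i <;> rcases t with j | j
    · exact hee i j
    · exact (hef i j).trans (by simp [symplJ, Matrix.one_apply, apply_ite])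
    · exact (hfe i j).trans (by simp [symplJ, Matrix.one_apply])
    · exact hff i j
  · ext s t
    rcases eq_or_ne s t with rfl | hst
    · rw [Matrix.diagonal_apply_eq]
    rw [Matrix.diagonal_apply_ne _ hst, transpose_mul_mul_apply_eq_toBilin']
    rcases s with i | i <;> rcases t with j | j
    · exact gee i j fun h => hst (congrArg _ h)
    · exact gef i j
    · exact gfe i j
    · exact gff i j fun h => hst (congrArg _ h)

/-- Every antisymmetric `A` is `-R * J * R` for some symmetric `R`. -/
theorem exists_symmetric_mul_symplJ_mul_eq_neg
    {A : Matrix (Fin n ⊕ Fin n) (Fin n ⊕ Fin n) ℝ} (hA : Aᵀ = -A) :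
    ∃ R : Matrix (Fin n ⊕ Fin n) (Fin n ⊕ Fin n) ℝ, Rᵀ = R ∧ R * symplJ n * R = -A := by
  have hJJ (N : Matrix (Fin n ⊕ Fin n) (Fin n ⊕ Fin n) ℝ) : symplJ n * (symplJ n * N) = -N := by
    rw [← Matrix.mul_assoc, symplJ_mul_symplJ, neg_one_mul]
  obtain ⟨Y, hsq, hskew⟩ := isAlt_toBilin'_symplJ.exists_skewAdjoint_sq_eq
    nondegenerate_toBilin'_symplJ (W := Matrix.toLin' (-(symplJ n * A))) (fun x y => by
      simp only [Matrix.toBilin'_apply', Matrix.toLin'_apply, Matrix.mulVec_mulVec, mul_neg, hJJ,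
        neg_neg]
      rw [Matrix.dotProduct_mulVec, ← Matrix.mulVec_transpose, Matrix.mulVec_mulVec,
        symplJ_transpose, mul_neg, neg_mul, neg_neg, hJJ, Matrix.dotProduct_mulVec x,
        ← Matrix.mulVec_transpose, hA])
  set Z := LinearMap.toMatrix' Y with hZ
  have hY (x) : Y x = Z *ᵥ x := (LinearMap.toMatrix'_mulVec Y x).symm
  have hZsq : Z * Z = -(symplJ n * A) := by
    apply Matrix.toLin'.injective
    refine LinearMap.ext fun x => ?_
    rw [Matrix.toLin'_apply, ← Matrix.mulVec_mulVec, ← hY, ← hY, hsq]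
  have hZskew : Zᵀ * symplJ n = -(symplJ n * Z) := by
    apply Matrix.toBilin'.injective
    refine LinearMap.ext₂ fun x y => ?_
    have := hskew x y
    simp only [Matrix.toBilin'_apply', hY, Matrix.mulVec_mulVec] at this ⊢
    rw [Matrix.neg_mulVec, dotProduct_neg, ← this, ← Matrix.mulVec_mulVec,
      Matrix.dotProduct_mulVec x, Matrix.vecMul_transpose]
  refine ⟨-(symplJ n * Z), ?_, ?_⟩
  · rw [Matrix.transpose_neg, Matrix.transpose_mul, symplJ_transpose, mul_neg, neg_neg, hZskew]
  · calc -(symplJ n * Z) * symplJ n * -(symplJ n * Z)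
        = symplJ n * Z * (symplJ n * (symplJ n * Z)) := by noncomm_ring
      _ = -A := by rw [hJJ, mul_neg, Matrix.mul_assoc, hZsq, mul_neg, hJJ]; simp

theorem exists_symplectic_mul_eq_Dmat_mul {M : Matrix (Fin n ⊕ Fin n) (Fin n ⊕ Fin n) ℝ}
    (hM : M.det ≠ 0) :
    ∃ S R : Matrix (Fin n ⊕ Fin n) (Fin n ⊕ Fin n) ℝ,
      S * symplJ n * Sᵀ = symplJ n ∧ Rᵀ = R ∧ S * M = Dmat n * R := by
  obtain ⟨R, hR, hRJR⟩ := exists_symmetric_mul_symplJ_mul_eq_neg (A := Mᵀ * symplJ n * M) (by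
    simp [Matrix.transpose_mul, symplJ_transpose, Matrix.mul_assoc])
  have hMM : M * M⁻¹ = 1 := Matrix.mul_nonsing_inv M hM.isUnit
  have hMM' : M⁻¹ * M = 1 := Matrix.nonsing_inv_mul M hM.isUnit
  refine ⟨Dmat n * R * M⁻¹, R, symplectic_iff_transpose.2 ?_, hR, ?_⟩
  · calc (Dmat n * R * M⁻¹)ᵀ * symplJ n * (Dmat n * R * M⁻¹)
        = M⁻¹ᵀ * (R * (Dmat n * symplJ n * Dmat n) * R) * M⁻¹ := by
          simp only [Matrix.transpose_mul, hR, Dmat_transpose, Matrix.mul_assoc]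
      _ = (M * M⁻¹)ᵀ * symplJ n * (M * M⁻¹) := by
          rw [Dmat_mul_symplJ_mul_Dmat, mul_neg, neg_mul, hRJR, neg_neg]
          simp only [Matrix.transpose_mul, Matrix.mul_assoc]
      _ = symplJ n := by rw [hMM]; simp
  · rw [Matrix.mul_assoc, hMM', Matrix.mul_one]

theorem det_ne_zero_of_symplectic {S : Matrix (Fin n ⊕ Fin n) (Fin n ⊕ Fin n) ℝ}
    (hS : S * symplJ n * Sᵀ = symplJ n) : S.det ≠ 0 :=
  (SymplecticGroup.symplectic_det (SymplecticGroup.mem_iff.2 hS)).ne_zero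

end SymplecticMatrices

/-- A bosonic Gaussian channel `(K, l, α)` with `det K ≠ 0` can be brought by inhomogeneous
symplectic transformations to the form `(D·R, 0, Λ)` with `R` symmetric and `Λ` diagonal. -/
theorem stmt_15 (n : ℕ) (K α : Matrix (Fin n ⊕ Fin n) (Fin n ⊕ Fin n) ℝ)
    (l : (Fin n ⊕ Fin n) → ℝ)
    (hgauss : IsBosonicGaussianChannel n K l α) (hK : K.det ≠ 0) :
    ∃ S₁ S₂ : Matrix (Fin n ⊕ Fin n) (Fin n ⊕ Fin n) ℝ,
      ∃ h₁ h₂ : (Fin n ⊕ Fin n) → ℝ,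
        ∃ R Λ : Matrix (Fin n ⊕ Fin n) (Fin n ⊕ Fin n) ℝ,
          S₁ * symplJ n * S₁ᵀ = symplJ n ∧ S₂ * symplJ n * S₂ᵀ = symplJ n ∧
          Rᵀ = R ∧ (∃ d : (Fin n ⊕ Fin n) → ℝ, Λ = Matrix.diagonal d) ∧
          S₁ * K * S₂ = Dmat n * R ∧
          S₂ᵀ *ᵥ (Kᵀ *ᵥ h₁) + S₂ᵀ *ᵥ l + h₂ = 0 ∧
          S₂ᵀ * α * S₂ = Λ := by
  obtain ⟨S₂, hS₂, d, hd⟩ :=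
    exists_symplectic_diagonalization hgauss.1 hgauss.dotProduct_mulVec_nonneg
  have hdet : (K * S₂).det ≠ 0 := by
    rw [Matrix.det_mul]
    exact mul_ne_zero hK (det_ne_zero_of_symplectic hS₂)
  obtain ⟨S₁, R, hS₁, hR, hSR⟩ := exists_symplectic_mul_eq_Dmat_mul hdet
  exact ⟨S₁, S₂, 0, -(S₂ᵀ *ᵥ l), R, Matrix.diagonal d, hS₁, hS₂, hR, ⟨d, rfl⟩,
    by rw [Matrix.mul_assoc, hSR], by simp, hd⟩
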